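/- Let n ≥ 2, 0 < α ≤ (n−1)/2 and s > (n−α−1)/2. Then there is a constant C > 0 such that for every finite Borel measure μ on ℝⁿ supported in B(0,1) with [μ]_α < ∞ and every Schwartz function f on ℝⁿ one has ∫₀¹ ∫_{ℝⁿ} |e^{it√(−Δ)}f(x)|² dμ(x) dt ≤ C [μ]_α ‖f‖²_{H^s}. -/

import Mathlib

open MeasureTheory Real Metric
open scoped ENNReal RealInnerProductSpace

noncomputable section

abbrev E (n : ℕ) : Type := EuclideanSpace ℝ (Fin n)

/-- The Frostman constant `[μ]_α = sup_{x,r>0} μ(B(x,r))/r^α`. -/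
def frostman {d : ℕ} (μ : Measure (E d)) (α : ℝ) : ℝ≥0∞ :=
  ⨆ (x : E d) (r : ℝ) (_ : 0 < r), μ (Metric.ball x r) / ENNReal.ofReal (r ^ α)

/-- The Fourier transform `f̂(ξ) = ∫ e^{-2πi x·ξ} f(x) dx`. -/
def FT {n : ℕ} (f : E n → ℂ) (ξ : E n) : ℂ :=
  ∫ x, Complex.exp (((-2 * π * ⟪x, ξ⟫ : ℝ) : ℂ) * Complex.I) * f x

/-- The Sobolev norm `‖f‖_{H^s} = (∫ (1+|ξ|²)^s |f̂(ξ)|² dξ)^{1/2}`. -/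
def sobolevNorm {n : ℕ} (f : E n → ℂ) (s : ℝ) : ℝ :=
  (∫ ξ : E n, (1 + ‖ξ‖ ^ 2) ^ s * ‖FT f ξ‖ ^ 2) ^ (1/2 : ℝ)

/-- The half-wave propagator `e^{it√(-Δ)}f(x) = ∫ e^{2πi(x·ξ+t|ξ|)} f̂(ξ) dξ`. -/
def halfWave {n : ℕ} (f : E n → ℂ) (t : ℝ) (x : E n) : ℂ :=
  ∫ ξ : E n, Complex.exp (((2 * π * (⟪x, ξ⟫ + t * ‖ξ‖) : ℝ) : ℂ) * Complex.I) * FT f ξ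

open scoped NNReal ComplexConjugate FourierTransform SchwartzMap

/-- The surface measure of the unit sphere, as a measure on the ambient space. -/
def sphereMeasure (n : ℕ) : Measure (E n) :=
  (volume : Measure (E n)).toSphere.map Subtype.val

/-- The radial measure `ρ ^ (n - 1) dρ` on the half-line. -/
def radialMeasure (n : ℕ) : Measure ℝ :=
  (volume.restrict (Set.Ioi 0)).withDensity fun r ↦ ENNReal.ofReal (r ^ (n - 1))

instance (n : ℕ) : IsFiniteMeasure (sphereMeasure n) := by
  unfold sphereMeasure; infer_instance

instance (n : ℕ) : SFinite (radialMeasure n) := by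
  unfold radialMeasure; infer_instance

lemma sphereMeasure_ae_norm (n : ℕ) : ∀ᵐ ω ∂(sphereMeasure n), ‖ω‖ = 1 := by
  unfold sphereMeasure
  rw [ae_map_iff (by fun_prop) (measurableSet_eq_fun (by fun_prop) (by fun_prop))]
  filter_upwards with ω
  simp

/-- Polar coordinates in `ℝⁿ`. -/
lemma measurePreserving_smul_sphereMeasure (n : ℕ) (hn : n ≠ 0) :
    MeasurePreserving (fun p : E n × ℝ ↦ p.2 • p.1)
      ((sphereMeasure n).prod (radialMeasure n)) volume := by
  have : Nonempty (Fin n) := ⟨⟨0, Nat.pos_of_ne_zero hn⟩⟩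
  have h := (volume : Measure (E n)).measurePreserving_homeomorphUnitSphereProd
  rw [finrank_euclideanSpace_fin] at h
  have hr : (Measure.volumeIoiPow (n - 1)).map Subtype.val = radialMeasure n := by
    ext s hs
    rw [Measure.map_apply measurable_subtype_coe hs, radialMeasure, withDensity_apply _ hs,
      Measure.volumeIoiPow, withDensity_apply _ (measurable_subtype_coe hs),
      ← map_comap_subtype_coe measurableSet_Ioi, setLIntegral_map hs (by fun_prop) (by fun_prop)]
  have hm : Measurable (fun p : E n × ℝ ↦ p.2 • p.1) := by fun_prop
  refine ⟨hm, ?_⟩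
  have hv : (Measure.comap Subtype.val volume).map
      (Subtype.val : ({0}ᶜ : Set (E n)) → E n) = volume := by
    rw [map_comap_subtype_coe (measurableSet_singleton _).compl, restrict_compl_singleton]
  refine Eq.trans ?_ hv
  rw [← hr, sphereMeasure, Measure.map_prod_map _ _ (by fun_prop) (by fun_prop),
    Measure.map_map hm (by fun_prop), ← h.map_eq, Measure.map_map (by fun_prop) h.measurable]
  congr 1
  ext1 x
  exact congrArg Subtype.val ((homeomorphUnitSphereProd (E n)).symm_apply_apply x)

open scoped Pointwise in
lemma measurePreserving_isometry_sphereMeasure (n : ℕ) (L : E n ≃ₗᵢ[ℝ] E n) :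
    MeasurePreserving L (sphereMeasure n) (sphereMeasure n) := by
  refine ⟨L.continuous.measurable, ?_⟩
  ext s hs
  have key : ∀ s : Set (E n), MeasurableSet s → sphereMeasure n s =
      n * volume (Set.Ioo (0:ℝ) 1 • (sphere 0 1 ∩ s)) := by
    intro s hs
    rw [sphereMeasure, Measure.map_apply (by fun_prop) hs,
      Measure.toSphere_apply' _ (measurable_subtype_coe hs), Subtype.image_preimage_coe]
    simp
  rw [Measure.map_apply L.continuous.measurable hs, key _ hs,
    key _ (L.continuous.measurable hs),
    ← L.measurePreserving.measure_preimage_equiv (f := L.toHomeomorph.toMeasurableEquiv)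
      (Set.Ioo (0 : ℝ) 1 • (sphere 0 1 ∩ s))]
  congr 2
  ext x
  simp only [Set.mem_smul, Set.mem_preimage, Set.mem_inter_iff, mem_sphere_zero_iff_norm]
  constructor
  · rintro ⟨r, hr, y, ⟨h1, h2⟩, rfl⟩
    exact ⟨r, hr, L y, ⟨by simpa using h1, h2⟩, (L.map_smul r y).symm⟩
  · rintro ⟨r, hr, y, ⟨h1, h2⟩, h3⟩
    refine ⟨r, hr, L.symm y, ⟨by simpa using h1, by simpa using h2⟩, ?_⟩
    apply L.injective
    rw [L.map_smul, L.apply_symm_apply]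
    exact h3

lemma integral_sphereMeasure_inner_congr {n : ℕ} {F : Type*} [NormedAddCommGroup F]
    [NormedSpace ℝ F] (g : ℝ → F) {z w : E n} (h : ‖z‖ = ‖w‖) :
    ∫ ω, g ⟪z, ω⟫ ∂(sphereMeasure n) = ∫ ω, g ⟪w, ω⟫ ∂(sphereMeasure n) := by
  set L := (ℝ ∙ (z - w))ᗮ.reflection
  have hL : L z = w := Submodule.reflection_sub h
  have := (measurePreserving_isometry_sphereMeasure n L).integral_comp
    L.toHomeomorph.measurableEmbedding (fun ω ↦ g ⟪w, ω⟫)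
  rw [← this, ← hL]
  simp only [L.inner_map_map]

/-- Differentiation under an integral over the sphere. -/
lemma hasDerivAt_integral_sphereMeasure {n : ℕ} {f f' : ℝ → E n → ℝ}
    (hf : ∀ t, Continuous (f t)) (hf' : Continuous fun p : ℝ × E n ↦ f' p.1 p.2)
    (h : ∀ t ω, HasDerivAt (fun t ↦ f t ω) (f' t ω) t) (t : ℝ) :
    HasDerivAt (fun t ↦ ∫ ω, f t ω ∂(sphereMeasure n))
      (∫ ω, f' t ω ∂(sphereMeasure n)) t := by
  obtain ⟨M, hM⟩ := ((isCompact_closedBall t 1).prod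
    (isCompact_sphere (0 : E n) 1)).exists_bound_of_continuousOn hf'.continuousOn
  obtain ⟨M', hM'⟩ := (isCompact_sphere (0 : E n) 1).exists_bound_of_continuousOn
    (hf t).continuousOn
  refine (hasDerivAt_integral_of_dominated_loc_of_deriv_le (F' := f') (bound := fun _ ↦ M)
    (ball_mem_nhds t one_pos) (.of_forall fun t ↦ (hf t).aestronglyMeasurable) ?_ ?_ ?_
    (integrable_const _) (.of_forall fun ω t _ ↦ h t ω)).2
  · refine Integrable.of_bound (hf t).aestronglyMeasurable M' ?_
    filter_upwards [sphereMeasure_ae_norm n] with ω hω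
    exact hM' ω (by simpa using hω)
  · exact (hf'.comp (by fun_prop : Continuous fun ω : E n ↦ (t, ω))).aestronglyMeasurable
  · filter_upwards [sphereMeasure_ae_norm n] with ω hω t' ht'
    exact hM (t', ω) ⟨ball_subset_closedBall ht', by simpa using hω⟩

lemma integrable_sphereMeasure {n : ℕ} {f : E n → ℝ} (hf : Continuous f) :
    Integrable f (sphereMeasure n) := by
  obtain ⟨M', hM'⟩ := (isCompact_sphere (0 : E n) 1).exists_bound_of_continuousOn hf.continuousOn
  refine Integrable.of_bound hf.aestronglyMeasurable M' ?_
  filter_upwards [sphereMeasure_ae_norm n] with ω hω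
  exact hM' ω (by simpa using hω)

lemma integral_sin_sphereMeasure {n : ℕ} (z : E n) :
    ∫ ω, sin ⟪z, ω⟫ ∂(sphereMeasure n) = 0 := by
  have h := integral_sphereMeasure_inner_congr sin (norm_neg z)
  simp only [inner_neg_left, sin_neg, integral_neg] at h
  linarith

/-- The sphere measure is invariant under infinitesimal rotations. -/
lemma integral_inner_sq_mul_cos_sphereMeasure {n : ℕ} {e v : E n} (he : ‖e‖ = 1) (hv : ‖v‖ = 1)
    (hev : ⟪e, v⟫ = 0) (r : ℝ) :
    r * (r * ∫ ω, ⟪v, ω⟫ ^ 2 * cos (r * ⟪e, ω⟫) ∂(sphereMeasure n)) =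
      r * ∫ ω, ⟪e, ω⟫ * sin (r * ⟪e, ω⟫) ∂(sphereMeasure n) := by
  set a : ℝ → E n → ℝ := fun θ ω ↦ r * (cos θ * ⟪e, ω⟫ + sin θ * ⟪v, ω⟫) with ha
  set b : ℝ → E n → ℝ := fun θ ω ↦ r * (-sin θ * ⟪e, ω⟫ + cos θ * ⟪v, ω⟫) with hb
  have hda : ∀ θ ω, HasDerivAt (fun θ ↦ a θ ω) (b θ ω) θ := fun θ ω ↦
    (((hasDerivAt_cos θ).mul_const _).add ((hasDerivAt_sin θ).mul_const _)).const_mul r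
  have hdb : ∀ θ ω, HasDerivAt (fun θ ↦ b θ ω) (-a θ ω) θ := fun θ ω ↦ by
    refine ((((hasDerivAt_sin θ).neg.mul_const ⟪e, ω⟫).add
      ((hasDerivAt_cos θ).mul_const ⟪v, ω⟫)).const_mul r).congr_deriv ?_
    simp only [ha]; ring
  have hconst : ∀ θ, ∫ ω, cos (a θ ω) ∂(sphereMeasure n) =
      ∫ ω, cos (a 0 ω) ∂(sphereMeasure n) := by
    intro θ
    have hnorm : ∀ θ, ‖r • (cos θ • e + sin θ • v)‖ = |r| := by
      intro θ
      have : ‖cos θ • e + sin θ • v‖ ^ 2 = 1 := by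
        rw [norm_add_sq_real]
        simp [norm_smul, inner_smul_left, inner_smul_right, he, hv, hev]
      rw [norm_smul, (sq_eq_sq₀ (norm_nonneg _) one_pos.le).1 (this.trans (one_pow 2).symm),
        norm_eq_abs, mul_one]
    have := integral_sphereMeasure_inner_congr cos ((hnorm θ).trans (hnorm 0).symm)
    simpa only [inner_smul_left, inner_add_left, conj_trivial] using this
  have h1 : ∀ θ, ∫ ω, -sin (a θ ω) * b θ ω ∂(sphereMeasure n) = 0 := by
    intro θ
    have := hasDerivAt_integral_sphereMeasure (f := fun θ ω ↦ cos (a θ ω))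
      (f' := fun θ ω ↦ -sin (a θ ω) * b θ ω) (by fun_prop) (by fun_prop)
      (fun θ ω ↦ (hda θ ω).cos) θ
    simp only [hconst] at this
    exact this.unique (hasDerivAt_const _ _)
  have h2 := hasDerivAt_integral_sphereMeasure (n := n)
    (f := fun θ ω ↦ -sin (a θ ω) * b θ ω)
    (f' := fun θ ω ↦ -(cos (a θ ω) * b θ ω) * b θ ω + -sin (a θ ω) * -a θ ω)
    (by fun_prop) (by fun_prop) (fun θ ω ↦ (hda θ ω).sin.neg.mul (hdb θ ω)) 0
  simp only [h1] at h2
  have h3 := h2.unique (hasDerivAt_const _ _)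
  rw [integral_add (integrable_sphereMeasure (by fun_prop))
    (integrable_sphereMeasure (by fun_prop))] at h3
  simp only [ha, hb, cos_zero, sin_zero, one_mul, zero_mul, add_zero, neg_zero, zero_add] at h3
  rw [← integral_const_mul, ← integral_const_mul, ← integral_const_mul]
  have e1 : ∫ ω, r * (r * (⟪v, ω⟫ ^ 2 * cos (r * ⟪e, ω⟫))) ∂(sphereMeasure n) =
    - ∫ ω, -(cos (r * ⟪e, ω⟫) * (r * ⟪v, ω⟫)) * (r * ⟪v, ω⟫) ∂(sphereMeasure n) := by
    rw [← integral_neg]; congr 1; ext ω; ring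
  have e2 : ∫ ω, r * (⟪e, ω⟫ * sin (r * ⟪e, ω⟫)) ∂(sphereMeasure n) =
    ∫ ω, -sin (r * ⟪e, ω⟫) * -(r * ⟪e, ω⟫) ∂(sphereMeasure n) := by
    congr 1; ext ω; ring
  linarith

/-- Solutions of the Bessel-type equation `φ'' + (m / r) φ' + φ = 0` decay like `r ^ (-m / 2)`. -/
lemma exists_sq_le_rpow_of_bessel {m : ℝ} (hm : 0 < m) {φ φ' φ'' : ℝ → ℝ}
    (h1 : ∀ r, HasDerivAt φ (φ' r) r) (h2 : ∀ r, HasDerivAt φ' (φ'' r) r)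
    (hode : ∀ r, 0 < r → r * (φ'' r + φ r) = -(m * φ' r)) :
    ∃ C, 0 ≤ C ∧ ∀ r, 2 * m ≤ r → φ r ^ 2 ≤ C * r ^ (-m) := by
  set Q : ℝ → ℝ := fun r ↦ φ' r ^ 2 + φ r ^ 2 + m * r⁻¹ * (φ r * φ' r) with hQ
  set V : ℝ → ℝ := fun r ↦ r ^ m * Q r * exp (m * r⁻¹) with hV
  have hm2 : ∀ r, 2 * m ≤ r → 0 < r := fun r hr ↦ by linarith
  have hinv : ∀ r, 2 * m ≤ r → m * r⁻¹ ≤ 1 / 2 := fun r hr ↦ by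
    have := hm2 r hr
    rw [← div_eq_mul_inv, div_le_iff₀ this]; linarith
  have hlow : ∀ r, 2 * m ≤ r → 3 / 4 * (φ' r ^ 2 + φ r ^ 2) ≤ Q r := fun r hr ↦ by
    have h3 := hinv r hr
    have h4 : 0 < m * r⁻¹ := mul_pos hm (inv_pos.2 (hm2 r hr))
    simp only [hQ]
    nlinarith [mul_nonneg h4.le (sq_nonneg (φ r + φ' r)), sq_nonneg (φ r), sq_nonneg (φ' r),
      mul_nonneg (sub_nonneg.2 h3) (add_nonneg (sq_nonneg (φ r)) (sq_nonneg (φ' r)))]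
  have hder : ∀ r, 2 * m ≤ r → HasDerivAt V
      (-(r ^ m * m * (r⁻¹) ^ 2 * (φ r * φ' r + Q r) * exp (m * r⁻¹))) r := by
    intro r hr
    have hr0 := hm2 r hr
    have hinv' : HasDerivAt (fun r : ℝ ↦ m * r⁻¹) (m * (-(r ^ 2)⁻¹)) r :=
      (hasDerivAt_inv hr0.ne').const_mul m
    have hQ' : HasDerivAt Q (2 * φ' r * φ'' r + 2 * φ r * φ' r +
        (m * (-(r ^ 2)⁻¹) * (φ r * φ' r) + m * r⁻¹ * (φ' r * φ' r + φ r * φ'' r))) r := by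
      have := (((h2 r).pow 2).add ((h1 r).pow 2)).add (hinv'.mul ((h1 r).mul (h2 r)))
      refine this.congr_deriv ?_
      simp
    refine ((((hasDerivAt_rpow_const (p := m) (Or.inl hr0.ne')).mul hQ').mul
      hinv'.exp)).congr_deriv ?_
    have ho : φ'' r = -φ r - m * r⁻¹ * φ' r := by
      have := hode r hr0
      field_simp
      linarith
    rw [rpow_sub_one hr0.ne', ho]
    simp only [Pi.mul_apply, hQ]
    field_simp
    ring
  have hanti : AntitoneOn V (Set.Ici (2 * m)) := by
    refine antitoneOn_of_deriv_nonpos (convex_Ici _)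
      (fun r hr ↦ (hder r hr).continuousAt.continuousWithinAt) ?_ ?_
    · intro r hr
      rw [interior_Ici] at hr
      exact (hder r (le_of_lt hr)).differentiableAt.differentiableWithinAt
    · intro r hr
      rw [interior_Ici] at hr
      have hr' : 2 * m ≤ r := le_of_lt hr
      rw [(hder r hr').deriv, Left.neg_nonpos_iff]
      have := hlow r hr'
      have : 0 ≤ φ r * φ' r + Q r := by
        nlinarith [sq_nonneg (φ r + φ' r), sq_nonneg (φ r), sq_nonneg (φ' r)]
      have := hm2 r hr'
      positivity
  have hVlow : ∀ r, 2 * m ≤ r → 3 / 4 * r ^ m * φ r ^ 2 ≤ V r := by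
    intro r hr
    have h3 := hlow r hr
    have h4 : 0 < r ^ m := rpow_pos_of_pos (hm2 r hr) m
    have h5 : 1 ≤ exp (m * r⁻¹) := by
      have := hm2 r hr
      exact one_le_exp (by positivity)
    have h6 : 3 / 4 * φ r ^ 2 ≤ Q r := by nlinarith [sq_nonneg (φ' r)]
    calc 3 / 4 * r ^ m * φ r ^ 2 = r ^ m * (3 / 4 * φ r ^ 2) * 1 := by ring
      _ ≤ V r := by
        simp only [hV]
        have : 0 ≤ Q r := le_trans (by positivity) h6
        gcongr
  refine ⟨4 / 3 * V (2 * m), ?_, fun r hr ↦ ?_⟩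
  · have := hVlow (2 * m) le_rfl
    have : 0 ≤ V (2 * m) := le_trans (by positivity) this
    positivity
  · have h3 := (hVlow r hr).trans (hanti (Set.mem_Ici.2 le_rfl) hr hr)
    have h4 : 0 < r ^ m := rpow_pos_of_pos (hm2 r hr) m
    rw [rpow_neg (hm2 r hr).le, ← div_eq_mul_inv, le_div_iff₀ h4]
    linarith

lemma exists_abs_integral_cos_sphereMeasure_le {n : ℕ} (hn : 2 ≤ n) {β : ℝ} (hβ₀ : 0 ≤ β)
    (hβ : β ≤ ((n : ℝ) - 1) / 2) :
    ∃ C : ℝ, 0 < C ∧ ∀ z : E n, z ≠ 0 →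
      |∫ ω, cos ⟪z, ω⟫ ∂(sphereMeasure n)| ≤ C * ‖z‖ ^ (-β) := by
  have hn' : (2 : ℝ) ≤ n := by exact_mod_cast hn
  set m : ℝ := n - 1 with hm_def
  have hm : 1 ≤ m := by linarith
  set b := EuclideanSpace.basisFun (Fin n) ℝ
  set i₀ : Fin n := ⟨0, by omega⟩
  set e := b i₀ with he_def
  have he : ‖e‖ = 1 := b.norm_eq_one i₀
  set φ : ℝ → ℝ := fun r ↦ ∫ ω, cos (r * ⟪e, ω⟫) ∂(sphereMeasure n) with hφ
  set φ' : ℝ → ℝ := fun r ↦ ∫ ω, -sin (r * ⟪e, ω⟫) * ⟪e, ω⟫ ∂(sphereMeasure n) with hφ'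
  set φ'' : ℝ → ℝ := fun r ↦ ∫ ω, -(cos (r * ⟪e, ω⟫) * ⟪e, ω⟫) * ⟪e, ω⟫ ∂(sphereMeasure n)
    with hφ''
  have hd : ∀ (c r : ℝ), HasDerivAt (fun r ↦ r * c) c r := fun c r ↦ by
    simpa using (hasDerivAt_id r).mul_const c
  have h1 : ∀ r, HasDerivAt φ (φ' r) r :=
    hasDerivAt_integral_sphereMeasure (by fun_prop) (by fun_prop) fun r ω ↦ (hd _ r).cos
  have h2 : ∀ r, HasDerivAt φ' (φ'' r) r :=
    hasDerivAt_integral_sphereMeasure (by fun_prop) (by fun_prop) fun r ω ↦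
      ((hd _ r).sin.neg.mul_const _)
  have hode : ∀ r, 0 < r → r * (φ'' r + φ r) = -(m * φ' r) := by
    intro r hr
    have key : ∀ i ∈ Finset.univ.erase i₀,
        r * ∫ ω, ⟪b i, ω⟫ ^ 2 * cos (r * ⟪e, ω⟫) ∂(sphereMeasure n) = -φ' r := by
      intro i hi
      have := integral_inner_sq_mul_cos_sphereMeasure he (b.norm_eq_one i)
        (b.orthonormal.2 (Finset.ne_of_mem_erase hi).symm) r
      rw [mul_left_cancel₀ hr.ne' this, hφ', ← integral_neg]
      congr 1; ext ω; ring
    have hsum := Finset.sum_congr rfl key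
    rw [Finset.sum_const, Finset.card_erase_of_mem (Finset.mem_univ _), Finset.card_univ,
      Fintype.card_fin, nsmul_eq_mul, Nat.cast_sub (by omega), Nat.cast_one, ← Finset.mul_sum,
      ← integral_finsetSum _ fun i _ ↦ integrable_sphereMeasure (by fun_prop)] at hsum
    have : φ'' r + φ r = ∫ ω, ∑ i ∈ Finset.univ.erase i₀, ⟪b i, ω⟫ ^ 2 * cos (r * ⟪e, ω⟫)
        ∂(sphereMeasure n) := by
      rw [hφ, hφ'', ← integral_add (integrable_sphereMeasure (by fun_prop))
        (integrable_sphereMeasure (by fun_prop))]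
      refine integral_congr_ae ?_
      filter_upwards [sphereMeasure_ae_norm n] with ω hω
      have h3 := b.sum_sq_norm_inner_right ω
      rw [hω, ← Finset.add_sum_erase _ _ (Finset.mem_univ i₀)] at h3
      simp only [norm_eq_abs, sq_abs] at h3
      rw [← Finset.sum_mul]
      linear_combination cos (r * ⟪e, ω⟫) * (-h3)
    rw [this, hsum]; ring
  obtain ⟨C, hC0, hC⟩ := exists_sq_le_rpow_of_bessel (by linarith) h1 h2 hode
  set M := (sphereMeasure n).real Set.univ
  have hM : ∀ r, |φ r| ≤ M := fun r ↦ by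
    have := norm_integral_le_of_norm_le_const (μ := sphereMeasure n)
      (f := fun ω ↦ cos (r * ⟪e, ω⟫)) (C := 1) (.of_forall fun ω ↦ abs_cos_le_one _)
    simpa using this
  have hM0 : 0 ≤ M := measureReal_nonneg
  refine ⟨√C + M * (2 * m) ^ β + 1, by positivity, fun z hz ↦ ?_⟩
  have hz' : 0 < ‖z‖ := norm_pos_iff.2 hz
  have hφz : ∫ ω, cos ⟪z, ω⟫ ∂(sphereMeasure n) = φ ‖z‖ := by
    rw [integral_sphereMeasure_inner_congr cos (w := ‖z‖ • e) (by simp [norm_smul, he])]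
    simp only [inner_smul_left, conj_trivial, hφ]
  rw [hφz]
  have hp : 0 < ‖z‖ ^ (-β) := rpow_pos_of_pos hz' _
  rcases le_or_gt (2 * m) ‖z‖ with h | h
  · have h3 : |φ ‖z‖| ≤ √C * ‖z‖ ^ (-β) := by
      refine abs_le_of_sq_le_sq ((hC _ h).trans ?_) (by positivity)
      rw [mul_pow, sq_sqrt hC0, ← rpow_natCast, ← rpow_mul hz'.le]
      gcongr
      · linarith
      · push_cast; linarith
    have : 0 ≤ M * (2 * m) ^ β := by positivity
    nlinarith
  · have h3 : 1 ≤ (2 * m) ^ β * ‖z‖ ^ (-β) := by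
      rw [rpow_neg hz'.le, ← div_eq_mul_inv, one_le_div (by positivity)]
      gcongr
    have : 0 ≤ √C := sqrt_nonneg _
    have := hM ‖z‖
    nlinarith [mul_le_mul_of_nonneg_left h3 hM0]

lemma exists_enorm_integral_exp_sphereMeasure_le {n : ℕ} (hn : 2 ≤ n) {β : ℝ} (hβ₀ : 0 < β)
    (hβ : β ≤ ((n : ℝ) - 1) / 2) :
    ∃ C : ℝ≥0, ∀ z : E n,
      ‖∫ ω, Complex.exp ((⟪z, ω⟫ : ℝ) * Complex.I) ∂(sphereMeasure n)‖ₑ ≤ C * ‖z‖ₑ ^ (-β) := by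
  obtain ⟨C, hC0, hC⟩ := exists_abs_integral_cos_sphereMeasure_le hn hβ₀.le hβ
  refine ⟨C.toNNReal, fun z ↦ ?_⟩
  rcases eq_or_ne z 0 with rfl | hz
  · rw [enorm_zero, ENNReal.zero_rpow_of_neg (neg_neg_of_pos hβ₀), ENNReal.mul_top (by simpa)]
    exact le_top
  have h1 : ∫ ω, Complex.exp ((⟪z, ω⟫ : ℝ) * Complex.I) ∂(sphereMeasure n) =
      ((∫ ω, cos ⟪z, ω⟫ ∂(sphereMeasure n) : ℝ) : ℂ) := by
    simp_rw [Complex.exp_mul_I]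
    have i1 : Integrable (fun ω : E n ↦ Complex.cos (⟪z, ω⟫ : ℝ)) (sphereMeasure n) := by
      simpa using (integrable_sphereMeasure (n := n) (f := fun ω ↦ cos ⟪z, ω⟫)
        (by fun_prop)).ofReal (𝕜 := ℂ)
    have i2 : Integrable (fun ω : E n ↦ Complex.sin (⟪z, ω⟫ : ℝ)) (sphereMeasure n) := by
      simpa using (integrable_sphereMeasure (n := n) (f := fun ω ↦ sin ⟪z, ω⟫)
        (by fun_prop)).ofReal (𝕜 := ℂ)
    rw [integral_add i1 (i2.mul_const _), integral_mul_const]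
    simp_rw [← Complex.ofReal_cos, ← Complex.ofReal_sin]
    rw [integral_complex_ofReal, integral_complex_ofReal, integral_sin_sphereMeasure]
    simp
  rw [h1, ← ofReal_norm, ← ofReal_norm, Complex.norm_real, norm_eq_abs,
    ENNReal.ofReal_rpow_of_pos (norm_pos_iff.2 hz)]
  exact (ENNReal.ofReal_le_ofReal (hC z hz)).trans_eq (ENNReal.ofReal_mul hC0.le)

lemma measure_ball_le_frostman {d : ℕ} (μ : Measure (E d)) (α : ℝ) (x : E d) {r : ℝ}
    (hr : 0 < r) : μ (ball x r) ≤ frostman μ α * ENNReal.ofReal (r ^ α) := by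
  have h : 0 < r ^ α := rpow_pos_of_pos hr α
  rw [← ENNReal.div_le_iff (by simpa using h) ENNReal.ofReal_ne_top]
  exact le_iSup₂_of_le x r (le_iSup_of_le hr le_rfl)

lemma measure_univ_le_frostman {d : ℕ} {μ : Measure (E d)} (α : ℝ)
    (hμ : μ (ball 0 1)ᶜ = 0) : μ Set.univ ≤ frostman μ α := by
  have := measure_ball_le_frostman μ α 0 one_pos
  rw [one_rpow, ENNReal.ofReal_one, mul_one] at this
  rwa [← measure_add_measure_compl (measurableSet_ball (x := (0 : E d)) (ε := 1)), hμ, add_zero]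

/-- The `β`-potential of an `α`-dimensional measure is bounded for `β < α`. -/
lemma exists_lintegral_enorm_sub_rpow_le {d : ℕ} {α β : ℝ} (hβ : 0 < β) (hβα : β < α) :
    ∃ C : ℝ≥0, ∀ μ : Measure (E d), μ (ball 0 1)ᶜ = 0 → ∀ x,
      ∫⁻ y, ‖x - y‖ₑ ^ (-β) ∂μ ≤ C * frostman μ α := by
  set q : ℝ := 2 ^ (β - α)
  have hq0 : 0 < q := by positivity
  have hq : q < 1 := rpow_lt_one_of_one_lt_of_neg one_lt_two (by linarith)
  have hpt : ∀ x y : E d, ‖x - y‖ₑ ^ (-β) ≤ 1 + ∑' k : ℕ,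
      ENNReal.ofReal (2 ^ (β * (k + 1))) * (ball x (2 * 2⁻¹ ^ k)).indicator 1 y := by
    intro x y
    rcases eq_or_ne x y with rfl | hxy
    · have hx : ∀ k : ℕ, x ∈ ball x (2 * 2⁻¹ ^ k) := fun k ↦ mem_ball_self (by positivity)
      simp only [Set.indicator_of_mem (hx _), Pi.one_apply, mul_one]
      have : ∑' k : ℕ, ENNReal.ofReal (2 ^ (β * (k + 1))) = ⊤ := by
        refine top_unique ?_
        rw [← ENNReal.tsum_const_eq_top_of_ne_zero (α := ℕ) one_ne_zero]
        refine ENNReal.tsum_le_tsum fun k ↦ ?_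
        rw [← ENNReal.ofReal_one]
        exact ENNReal.ofReal_le_ofReal (one_le_rpow one_le_two (by positivity))
      rw [this, add_top]
      exact le_top
    have h0 : 0 < dist y x := dist_pos.2 hxy.symm
    have hn : ‖x - y‖ₑ ^ (-β) = ENNReal.ofReal (dist y x ^ (-β)) := by
      rw [← ENNReal.ofReal_rpow_of_pos h0, ← edist_eq_enorm_sub, edist_comm, edist_dist]
    rw [hn]
    rcases le_or_gt 1 (dist y x) with h1 | h1
    · refine le_trans ?_ le_self_add
      rw [← ENNReal.ofReal_one]
      exact ENNReal.ofReal_le_ofReal (rpow_le_one_of_one_le_of_nonpos h1 (by linarith))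
    · obtain ⟨k, hk1, hk2⟩ := exists_nat_pow_near_of_lt_one h0 h1.le (y := (2⁻¹ : ℝ))
        (by norm_num) (by norm_num)
      refine le_trans ?_ le_add_self
      refine le_trans ?_ (ENNReal.le_tsum k)
      have hy : y ∈ ball x (2 * 2⁻¹ ^ k) := by
        have : (0 : ℝ) < 2⁻¹ ^ k := by positivity
        rw [mem_ball]
        linarith
      rw [Set.indicator_of_mem hy, Pi.one_apply, mul_one]
      refine ENNReal.ofReal_le_ofReal ((rpow_le_rpow_of_nonpos (by positivity) hk1.le
        (by linarith)).trans_eq ?_)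
      rw [← rpow_natCast, ← rpow_neg_one,
            ← rpow_mul two_pos.le, ← rpow_mul two_pos.le]
      push_cast
      ring_nf
  refine ⟨1 + (2 ^ (α + β) * (1 - q)⁻¹).toNNReal, fun μ hμ x ↦ ?_⟩
  calc ∫⁻ y, ‖x - y‖ₑ ^ (-β) ∂μ
      ≤ ∫⁻ y, (1 + ∑' k : ℕ,
        ENNReal.ofReal (2 ^ (β * (k + 1))) * (ball x (2 * 2⁻¹ ^ k)).indicator 1 y) ∂μ :=
        lintegral_mono (hpt x)
    _ = μ Set.univ + ∑' k : ℕ, ENNReal.ofReal (2 ^ (β * (k + 1))) * μ (ball x (2 * 2⁻¹ ^ k)) := by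
        rw [lintegral_add_left measurable_const, lintegral_tsum fun k ↦
          ((measurable_one.indicator measurableSet_ball).const_mul _).aemeasurable]
        simp [lintegral_const_mul _ (measurable_one.indicator measurableSet_ball),
          lintegral_indicator_one measurableSet_ball]
    _ ≤ frostman μ α + ∑' k : ℕ, ENNReal.ofReal (2 ^ (β * (k + 1))) *
        (frostman μ α * ENNReal.ofReal ((2 * 2⁻¹ ^ k) ^ α)) := by
        gcongr with k
        · exact measure_univ_le_frostman α hμ
        · exact measure_ball_le_frostman μ α x (by positivity)
    _ = frostman μ α + ∑' k : ℕ, ENNReal.ofReal (2 ^ (α + β) * q ^ k) * frostman μ α := by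
        congr 1
        refine tsum_congr fun k ↦ ?_
        have : (2 : ℝ) ^ (α + β) * q ^ k = 2 ^ (β * (k + 1)) * (2 * 2⁻¹ ^ k) ^ α := by
          rw [mul_rpow two_pos.le (by positivity), ← rpow_natCast, ← rpow_natCast, ← rpow_neg_one,
            ← rpow_mul two_pos.le,
            ← rpow_mul two_pos.le, ← rpow_mul two_pos.le, ← rpow_add two_pos,
            ← rpow_add two_pos, ← rpow_add two_pos]
          ring_nf
        rw [this, ENNReal.ofReal_mul (by positivity)]
        ring
    _ = (1 + (2 ^ (α + β) * (1 - q)⁻¹).toNNReal : ℝ≥0) * frostman μ α := by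
        rw [ENNReal.tsum_mul_right, ← ENNReal.ofReal_tsum_of_nonneg (fun k ↦ by positivity)
          ((summable_geometric_of_lt_one hq0.le hq).mul_left _), tsum_mul_left,
          tsum_geometric_of_lt_one hq0.le hq]
        push_cast
        rw [add_mul, one_mul]
        rfl

lemma enorm_integral_mul_conj_self {X : Type*} [MeasurableSpace X] {μ : Measure X} {T : X → ℂ}
    (hT : Integrable (fun x ↦ T x * conj (T x)) μ) :
    ‖∫ x, T x * conj (T x) ∂μ‖ₑ = ∫⁻ x, ‖T x‖ₑ ^ 2 ∂μ := by
  have h : ∀ x, T x * conj (T x) = ((‖T x‖ ^ 2 : ℝ) : ℂ) := fun x ↦ by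
    rw [Complex.mul_conj, Complex.normSq_eq_norm_sq]
  have hint : Integrable (fun x ↦ ‖T x‖ ^ 2) μ := by
    refine hT.norm.congr (.of_forall fun x ↦ ?_)
    simp [sq]
  simp_rw [h]
  rw [integral_complex_ofReal, ← ofReal_norm, Complex.norm_real,
    norm_of_nonneg (integral_nonneg fun x ↦ by positivity),
    ofReal_integral_eq_lintegral_ofReal hint (.of_forall fun x ↦ by positivity)]
  refine lintegral_congr fun x ↦ ?_
  rw [ENNReal.ofReal_pow (norm_nonneg _), ofReal_norm]

lemma norm_integral_mul_le_of_norm_le_one {X : Type*} [MeasurableSpace X] {μ : Measure X}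
    {k g : X → ℂ}
    (hk1 : ∀ x, ‖k x‖ ≤ 1) (hg : Integrable g μ) : ‖∫ x, k x * g x ∂μ‖ ≤ ∫ x, ‖g x‖ ∂μ :=
  norm_integral_le_of_norm_le hg.norm (.of_forall fun x ↦ by
    rw [norm_mul]; exact mul_le_of_le_one_left (norm_nonneg _) (hk1 x))

/-- Schur's test for `T* T`, where `T` is an integral operator. -/
lemma lintegral_enorm_integral_sq_le {X Y : Type*} [MeasurableSpace X] [MeasurableSpace Y]
    {μ : Measure X} [IsFiniteMeasure μ] {ν : Measure Y}
    [SFinite ν] {k : X → Y → ℂ} (hk : Measurable (Function.uncurry k))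
    (hk1 : ∀ x y, ‖k x y‖ ≤ 1) {g : Y → ℂ} (hg : Integrable g ν) {A : ℝ≥0∞}
    (hA : ∀ y, ∫⁻ y', ‖∫ x, k x y * conj (k x y') ∂μ‖ₑ ∂ν ≤ A) :
    ∫⁻ x, ‖∫ y, k x y * g y ∂ν‖ₑ ^ 2 ∂μ ≤ A * ∫⁻ y, ‖g y‖ₑ ^ 2 ∂ν := by
  set T : X → ℂ := fun x ↦ ∫ y, k x y * g y ∂ν with hT
  set K : Y × Y → ℂ := fun p ↦ ∫ x, k x p.1 * conj (k x p.2) ∂μ with hK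
  have hkx : ∀ x, Measurable (k x) := fun x ↦ hk.comp measurable_prodMk_left
  have hTm : AEStronglyMeasurable T μ := by
    have : AEStronglyMeasurable (fun p : X × Y ↦ k p.1 p.2 * g p.2) (μ.prod ν) :=
      hk.aestronglyMeasurable.mul hg.1.comp_snd
    exact this.integral_prod_right'
  have hTb : ∀ x, ‖T x‖ ≤ ∫ y, ‖g y‖ ∂ν := fun x ↦
    norm_integral_mul_le_of_norm_le_one (hk1 x) hg
  have hTi : Integrable T μ := Integrable.of_bound hTm _ (.of_forall hTb)
  have hTT : Integrable (fun x ↦ T x * conj (T x)) μ := by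
    refine hTi.mul_bdd (c := ∫ y, ‖g y‖ ∂ν) ?_ (.of_forall fun x ↦ ?_)
    · exact Complex.continuous_conj.comp_aestronglyMeasurable hTm
    · simpa using hTb x
  have hKm : Measurable K := by
    have : StronglyMeasurable (fun q : (Y × Y) × X ↦ k q.2 q.1.1 * conj (k q.2 q.1.2)) := by
      refine Measurable.stronglyMeasurable ?_
      refine (hk.comp (f := fun q : (Y × Y) × X ↦ (q.2, q.1.1)) (by fun_prop)).mul
        (Complex.continuous_conj.measurable.comp
          (hk.comp (f := fun q : (Y × Y) × X ↦ (q.2, q.1.2)) (by fun_prop)))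
    exact this.integral_prod_right'.measurable
  have hgg : Integrable (fun p : Y × Y ↦ g p.1 * conj (g p.2)) (ν.prod ν) :=
    hg.mul_prod (Complex.conjLIE.toContinuousLinearEquiv.toContinuousLinearMap.integrable_comp hg)
  have hbig : Integrable (fun q : X × (Y × Y) ↦
      (k q.1 q.2.1 * conj (k q.1 q.2.2)) * (g q.2.1 * conj (g q.2.2))) (μ.prod (ν.prod ν)) := by
    refine (hgg.comp_snd μ).bdd_mul (c := 1) ?_ (.of_forall fun q ↦ ?_)
    · refine Measurable.aestronglyMeasurable ?_
      refine (hk.comp (f := fun q : X × (Y × Y) ↦ (q.1, q.2.1)) (by fun_prop)).mul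
        (Complex.continuous_conj.measurable.comp
          (hk.comp (f := fun q : X × (Y × Y) ↦ (q.1, q.2.2)) (by fun_prop)))
    · rw [norm_mul, RCLike.norm_conj]
      exact mul_le_one₀ (hk1 _ _) (norm_nonneg _) (hk1 _ _)
  have hexp : ∫ x, T x * conj (T x) ∂μ = ∫ p, K p * (g p.1 * conj (g p.2)) ∂(ν.prod ν) := by
    calc ∫ x, T x * conj (T x) ∂μ = ∫ x, ∫ p : Y × Y,
        (k x p.1 * conj (k x p.2)) * (g p.1 * conj (g p.2)) ∂(ν.prod ν) ∂μ := by
          refine integral_congr_ae (.of_forall fun x ↦ ?_)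
          simp only [hT]
          rw [← integral_conj, ← integral_prod_mul]
          refine integral_congr_ae (.of_forall fun p ↦ ?_)
          simp only [map_mul]
          ring
      _ = _ := by
          rw [integral_integral_swap hbig]
          simp only [hK, integral_mul_const]
  have hKsymm : ∀ p, ‖K p.swap‖ₑ = ‖K p‖ₑ := by
    intro p
    have : K p.swap = conj (K p) := by
      simp only [hK, ← integral_conj, Prod.fst_swap, Prod.snd_swap]
      refine integral_congr_ae (.of_forall fun x ↦ ?_)
      simp [mul_comm]
    rw [this, ← ofReal_norm, RCLike.norm_conj, ofReal_norm]
  have hgm : AEMeasurable (fun y ↦ ‖g y‖ₑ ^ 2) ν := hg.1.enorm.pow_const 2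
  have hgm₁ : AEMeasurable (fun p : Y × Y ↦ ‖K p‖ₑ * ‖g p.1‖ₑ ^ 2) (ν.prod ν) :=
    hKm.enorm.aemeasurable.mul (hg.1.comp_fst.enorm.pow_const 2)
  have h1 : ∫⁻ p, ‖K p‖ₑ * ‖g p.1‖ₑ ^ 2 ∂(ν.prod ν) ≤ A * ∫⁻ y, ‖g y‖ₑ ^ 2 ∂ν := by
    rw [lintegral_prod _ hgm₁, ← lintegral_const_mul'' _ hgm]
    refine lintegral_mono fun y ↦ ?_
    dsimp only
    have hKy : Measurable fun y' ↦ ‖K (y, y')‖ₑ := (hKm.comp measurable_prodMk_left).enorm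
    rw [lintegral_mul_const _ hKy]
    gcongr
    exact hA y
  have h2 : ∫⁻ p, ‖K p‖ₑ * ‖g p.2‖ₑ ^ 2 ∂(ν.prod ν) ≤ A * ∫⁻ y, ‖g y‖ₑ ^ 2 ∂ν := by
    rw [← lintegral_prod_swap]
    simpa only [hKsymm, Prod.snd_swap] using h1
  have h3 : 2 * ∫⁻ x, ‖T x‖ₑ ^ 2 ∂μ ≤ 2 * (A * ∫⁻ y, ‖g y‖ₑ ^ 2 ∂ν) := by
    rw [← enorm_integral_mul_conj_self hTT, hexp]
    calc 2 * ‖∫ p, K p * (g p.1 * conj (g p.2)) ∂(ν.prod ν)‖ₑ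
        ≤ 2 * ∫⁻ p, ‖K p * (g p.1 * conj (g p.2))‖ₑ ∂(ν.prod ν) := by
          gcongr; exact enorm_integral_le_lintegral_enorm _
      _ ≤ ∫⁻ p, (‖K p‖ₑ * ‖g p.1‖ₑ ^ 2 + ‖K p‖ₑ * ‖g p.2‖ₑ ^ 2) ∂(ν.prod ν) := by
          rw [← lintegral_const_mul' _ _ ENNReal.ofNat_ne_top]
          refine lintegral_mono fun p ↦ ?_
          have h4 : ‖conj (g p.2)‖ₑ = ‖g p.2‖ₑ := by
            rw [← ofReal_norm, RCLike.norm_conj, ofReal_norm]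
          rw [enorm_mul, enorm_mul, h4, ← mul_add]
          calc 2 * (‖K p‖ₑ * (‖g p.1‖ₑ * ‖g p.2‖ₑ))
              = ‖K p‖ₑ * (2 * ‖g p.1‖ₑ * ‖g p.2‖ₑ) := by ring
            _ ≤ _ := by
              gcongr
              simp only [enorm_eq_nnnorm]
              exact_mod_cast two_mul_le_add_sq ‖g p.1‖₊ ‖g p.2‖₊
      _ ≤ 2 * (A * ∫⁻ y, ‖g y‖ₑ ^ 2 ∂ν) := by
          rw [lintegral_add_left' hgm₁, two_mul]
          gcongr
  exact (ENNReal.mul_le_mul_iff_right (by simp) (by simp)).1 h3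

/-- Schur's test for `T T*`, where `T` is an integral operator. -/
lemma lintegral_enorm_integral_sq_le_of_dual {X Y : Type*} [MeasurableSpace X] [MeasurableSpace Y]
    {μ : Measure X} [IsFiniteMeasure μ] {ν : Measure Y}
    [IsFiniteMeasure ν] {k : X → Y → ℂ} (hk : Measurable (Function.uncurry k))
    (hk1 : ∀ x y, ‖k x y‖ ≤ 1) {g : Y → ℂ} (hg : Integrable g ν) {A : ℝ≥0∞}
    (hA : ∀ x, ∫⁻ x', ‖∫ y, k x y * conj (k x' y) ∂ν‖ₑ ∂μ ≤ A) :
    ∫⁻ x, ‖∫ y, k x y * g y ∂ν‖ₑ ^ 2 ∂μ ≤ A * ∫⁻ y, ‖g y‖ₑ ^ 2 ∂ν := by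
  set T : X → ℂ := fun x ↦ ∫ y, k x y * g y ∂ν with hT
  have hkx : ∀ x, Measurable (k x) := fun x ↦ hk.comp measurable_prodMk_left
  have hTm : AEStronglyMeasurable T μ := by
    have : AEStronglyMeasurable (fun p : X × Y ↦ k p.1 p.2 * g p.2) (μ.prod ν) :=
      hk.aestronglyMeasurable.mul hg.1.comp_snd
    exact this.integral_prod_right'
  have hTb : ∀ x, ‖T x‖ ≤ ∫ y, ‖g y‖ ∂ν := fun x ↦
    norm_integral_mul_le_of_norm_le_one (hk1 x) hg
  have hTi : Integrable T μ := Integrable.of_bound hTm _ (.of_forall hTb)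
  have hTc : Integrable (fun x ↦ conj (T x)) μ :=
    Complex.conjLIE.toContinuousLinearEquiv.toContinuousLinearMap.integrable_comp hTi
  have hTT : Integrable (fun x ↦ T x * conj (T x)) μ := by
    refine hTi.mul_bdd (c := ∫ y, ‖g y‖ ∂ν) ?_ (.of_forall fun x ↦ ?_)
    · exact Complex.continuous_conj.comp_aestronglyMeasurable hTm
    · simpa using hTb x
  have hconj : ∀ x, ‖conj (T x)‖ₑ = ‖T x‖ₑ := fun x ↦ by
    rw [← ofReal_norm, RCLike.norm_conj, ofReal_norm]
  set Q := ∫⁻ x, ‖T x‖ₑ ^ 2 ∂μ with hQ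
  set N := ∫⁻ y, ‖g y‖ₑ ^ 2 ∂ν with hN
  have hQtop : Q ≠ ⊤ := by
    rw [hQ, ← enorm_integral_mul_conj_self hTT]
    exact enorm_ne_top
  set S : Y → ℂ := fun y ↦ ∫ x, k x y * conj (T x) ∂μ with hS
  have hSN : ∫⁻ y, ‖S y‖ₑ ^ 2 ∂ν ≤ A * Q := by
    have := lintegral_enorm_integral_sq_le (μ := ν) (ν := μ) (k := fun y x ↦ k x y)
      (hk.comp measurable_swap) (fun y x ↦ hk1 x y) hTc hA
    simpa only [hconj] using this
  have hSm : AEStronglyMeasurable S ν := by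
    have : AEStronglyMeasurable (fun p : Y × X ↦ k p.2 p.1 * conj (T p.2)) (ν.prod μ) :=
      (hk.comp measurable_swap).aestronglyMeasurable.mul hTc.1.comp_snd
    exact this.integral_prod_right'
  have hexp : ∫ x, T x * conj (T x) ∂μ = ∫ y, g y * S y ∂ν := by
    have hbig : Integrable (fun q : X × Y ↦ k q.1 q.2 * (conj (T q.1) * g q.2)) (μ.prod ν) :=
      (hTc.mul_prod hg).bdd_mul (c := 1) hk.aestronglyMeasurable (.of_forall fun q ↦ hk1 _ _)
    calc ∫ x, T x * conj (T x) ∂μ = ∫ x, ∫ y, k x y * (conj (T x) * g y) ∂ν ∂μ := by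
          refine integral_congr_ae (.of_forall fun x ↦ ?_)
          simp only
          conv_lhs => rw [hT]
          simp only
          rw [← integral_mul_const]
          refine integral_congr_ae (.of_forall fun y ↦ ?_)
          simp only [hT]
          ring
      _ = ∫ y, ∫ x, k x y * (conj (T x) * g y) ∂μ ∂ν := integral_integral_swap hbig
      _ = _ := by
          refine integral_congr_ae (.of_forall fun y ↦ ?_)
          simp only [hS]
          rw [← integral_const_mul]
          refine integral_congr_ae (.of_forall fun x ↦ ?_)
          simp only
          ring
  have hQle : Q ≤ (N) ^ (1 / 2 : ℝ) * (A * Q) ^ (1 / 2 : ℝ) := by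
    calc Q = ‖∫ y, g y * S y ∂ν‖ₑ := by rw [← hexp, enorm_integral_mul_conj_self hTT]
      _ ≤ ∫⁻ y, ‖g y‖ₑ * ‖S y‖ₑ ∂ν := by
          refine (enorm_integral_le_lintegral_enorm _).trans_eq ?_
          simp only [enorm_mul]
      _ ≤ (∫⁻ y, ‖g y‖ₑ ^ (2 : ℝ) ∂ν) ^ (1 / 2 : ℝ) * (∫⁻ y, ‖S y‖ₑ ^ (2 : ℝ) ∂ν) ^ (1 / 2 : ℝ) :=
          ENNReal.lintegral_mul_le_Lp_mul_Lq ν Real.HolderConjugate.two_two hg.1.enorm hSm.enorm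
      _ ≤ _ := by
          simp only [ENNReal.rpow_two]
          gcongr
  rcases eq_or_ne Q 0 with h0 | h0
  · rw [h0]; exact zero_le
  have hsq : Q * Q ≤ (A * N) * Q := by
    calc Q * Q
        ≤ (N ^ (1 / 2 : ℝ) * (A * Q) ^ (1 / 2 : ℝ)) * (N ^ (1 / 2 : ℝ) * (A * Q) ^ (1 / 2 : ℝ)) := by
          gcongr
      _ = (N ^ (1 / 2 : ℝ) * N ^ (1 / 2 : ℝ)) * ((A * Q) ^ (1 / 2 : ℝ) * (A * Q) ^ (1 / 2 : ℝ)) := by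
          ring
      _ = N * (A * Q) := by
          rw [← ENNReal.rpow_add_of_nonneg _ _ (by norm_num) (by norm_num),
            ← ENNReal.rpow_add_of_nonneg _ _ (by norm_num) (by norm_num)]
          norm_num
      _ = _ := by ring
  exact (ENNReal.mul_le_mul_iff_left h0 hQtop).1 hsq

lemma exp_ofReal_mul_I_mul_conj (x y : ℝ) :
    Complex.exp (x * Complex.I) * conj (Complex.exp (y * Complex.I)) =
      Complex.exp ((x - y : ℝ) * Complex.I) := by
  rw [← Complex.exp_conj, ← Complex.exp_add]
  congr 1
  simp
  ring

open ProbabilityTheory in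
lemma exists_lintegral_Ioc_le_gaussianReal : ∃ C : ℝ≥0, ∀ h : ℝ → ℝ≥0∞,
    ∫⁻ t in Set.Ioc (0 : ℝ) 1, h t ≤ C * ∫⁻ t, h t ∂(gaussianReal 0 1) := by
  set c : ℝ≥0∞ := gaussianPDF 0 1 1 with hc
  have hc0 : c ≠ 0 := (gaussianPDF_pos 0 one_ne_zero 1).ne'
  have hctop : c ≠ ⊤ := gaussianPDF_ne_top
  have hle : ∀ t ∈ Set.Ioc (0 : ℝ) 1, c ≤ gaussianPDF 0 1 t := by
    intro t ht
    have : t ^ 2 ≤ 1 := pow_le_one₀ ht.1.le ht.2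
    rw [hc, gaussianPDF, gaussianPDF]
    refine ENNReal.ofReal_le_ofReal ?_
    simp only [gaussianPDFReal]
    refine mul_le_mul_of_nonneg_left (Real.exp_le_exp.2 ?_) (by positivity)
    norm_num
    linarith
  refine ⟨(c⁻¹).toNNReal, fun h ↦ ?_⟩
  rw [ENNReal.coe_toNNReal (by simpa using hc0), gaussianReal_of_var_ne_zero 0 one_ne_zero,
    lintegral_withDensity_eq_lintegral_mul_non_measurable _ (measurable_gaussianPDF 0 1)
      (.of_forall fun _ ↦ gaussianPDF_lt_top),
    ← lintegral_const_mul' _ _ (by simpa using hc0)]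
  refine le_trans (setLIntegral_mono' measurableSet_Ioc fun t ht ↦ ?_)
    (setLIntegral_le_lintegral _ _)
  calc h t = c⁻¹ * c * h t := by rw [ENNReal.inv_mul_cancel hc0 hctop, one_mul]
    _ ≤ c⁻¹ * (gaussianPDF 0 1 t * h t) := by
      rw [mul_assoc]
      gcongr
      exact hle t ht

open ProbabilityTheory in
lemma exists_lintegral_Ioc_enorm_integral_sq_le : ∃ C : ℝ≥0, ∀ (S : Set ℝ) (g : ℝ → ℂ),
    IntegrableOn g S →
    ∫⁻ t in Set.Ioc (0 : ℝ) 1,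
      ‖∫ ρ in S, Complex.exp ((2 * π * (t * ρ) : ℝ) * Complex.I) * g ρ‖ₑ ^ 2 ≤
      C * ∫⁻ ρ in S, ‖g ρ‖ₑ ^ 2 := by
  obtain ⟨C, hC⟩ := exists_lintegral_Ioc_le_gaussianReal
  set A : ℝ≥0∞ := ∫⁻ ρ : ℝ, ENNReal.ofReal (Real.exp (-(2 * π ^ 2) * ρ ^ 2)) with hA
  have hAtop : A ≠ ⊤ :=
    (integrable_exp_neg_mul_sq (b := 2 * π ^ 2) (by positivity)).lintegral_lt_top.ne
  refine ⟨C * A.toNNReal, fun S g hg ↦ (hC _).trans ?_⟩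
  rw [ENNReal.coe_mul, ENNReal.coe_toNNReal hAtop, mul_assoc]
  gcongr
  refine lintegral_enorm_integral_sq_le
    (k := fun t ρ : ℝ ↦ Complex.exp ((2 * π * (t * ρ) : ℝ) * Complex.I)) ?_
    (fun t ρ ↦ (Complex.norm_exp_ofReal_mul_I _).le) hg fun y ↦ ?_
  · simp only [Function.uncurry_def]
    fun_prop
  · refine (setLIntegral_le_lintegral _ _).trans (le_of_eq ?_)
    rw [hA, ← lintegral_sub_left_eq_self
      (fun ρ ↦ ENNReal.ofReal (Real.exp (-(2 * π ^ 2) * ρ ^ 2))) y]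
    refine lintegral_congr fun y' ↦ ?_
    have h : ∫ t, Complex.exp ((2 * π * (t * y) : ℝ) * Complex.I) *
        conj (Complex.exp ((2 * π * (t * y') : ℝ) * Complex.I)) ∂(gaussianReal 0 1) =
        charFun (gaussianReal 0 1) (2 * π * (y - y')) := by
      rw [charFun_apply_real]
      refine integral_congr_ae (.of_forall fun t ↦ ?_)
      simp only
      rw [exp_ofReal_mul_I_mul_conj]
      congr 1
      push_cast
      ring
    rw [h, charFun_gaussianReal, ← ofReal_norm, Complex.norm_exp, ← Complex.ofReal_re (-_ * _)]
    congr 3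
    push_cast
    ring

/-- The `L²(dσ) → L²(μ)` bound for the extension operator of the sphere of radius `ρ`. -/
lemma exists_lintegral_enorm_integral_sphereMeasure_sq_le {n : ℕ} (hn : 2 ≤ n) {α β : ℝ}
    (hβ₀ : 0 < β) (hβ : β ≤ ((n : ℝ) - 1) / 2) (hβα : β < α) :
    ∃ C : ℝ≥0, ∀ μ : Measure (E n), IsFiniteMeasure μ → μ (ball 0 1)ᶜ = 0 → ∀ ρ : ℝ, 0 < ρ →
      ∀ g : E n → ℂ, Integrable g (sphereMeasure n) →
      ∫⁻ x, ‖∫ ω, Complex.exp ((2 * π * (ρ * ⟪x, ω⟫) : ℝ) * Complex.I) * g ω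
        ∂(sphereMeasure n)‖ₑ ^ 2 ∂μ ≤
      C * frostman μ α * ENNReal.ofReal ρ ^ (-β) * ∫⁻ ω, ‖g ω‖ₑ ^ 2 ∂(sphereMeasure n) := by
  obtain ⟨C₁, hC₁⟩ := exists_enorm_integral_exp_sphereMeasure_le hn hβ₀ hβ
  obtain ⟨C₂, hC₂⟩ := exists_lintegral_enorm_sub_rpow_le (d := n) hβ₀ hβα
  refine ⟨C₁ * C₂, fun μ _ hμ ρ hρ g hg ↦ ?_⟩
  refine lintegral_enorm_integral_sq_le_of_dual
    (k := fun x ω : E n ↦ Complex.exp ((2 * π * (ρ * ⟪x, ω⟫) : ℝ) * Complex.I)) ?_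
    (fun x ω ↦ (Complex.norm_exp_ofReal_mul_I _).le) hg fun x ↦ ?_
  · simp only [Function.uncurry_def]
    fun_prop
  · have hρ0 : ENNReal.ofReal ρ ≠ 0 := by simpa using hρ
    have hρtop : ENNReal.ofReal ρ ^ (-β) ≠ ⊤ :=
      ENNReal.rpow_ne_top_of_ne_zero hρ0 ENNReal.ofReal_ne_top
    have hk : ∀ x', ‖∫ ω, Complex.exp ((2 * π * (ρ * ⟪x, ω⟫) : ℝ) * Complex.I) *
        conj (Complex.exp ((2 * π * (ρ * ⟪x', ω⟫) : ℝ) * Complex.I)) ∂(sphereMeasure n)‖ₑ ≤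
        C₁ * ENNReal.ofReal ρ ^ (-β) * ‖x - x'‖ₑ ^ (-β) := by
      intro x'
      have h := hC₁ ((2 * π * ρ) • (x - x'))
      have h2 : ‖(2 * π * ρ) • (x - x')‖ₑ ^ (-β) ≤
          ENNReal.ofReal ρ ^ (-β) * ‖x - x'‖ₑ ^ (-β) := by
        rw [← ENNReal.mul_rpow_of_ne_top ENNReal.ofReal_ne_top enorm_ne_top, ENNReal.rpow_neg,
          ENNReal.rpow_neg, enorm_smul, Real.enorm_of_nonneg (by positivity)]
        have : ρ ≤ 2 * π * ρ := by nlinarith [pi_gt_three]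
        exact ENNReal.inv_le_inv.2 (by gcongr)
      calc _ = ‖∫ ω, Complex.exp ((⟪(2 * π * ρ) • (x - x'), ω⟫ : ℝ) * Complex.I)
            ∂(sphereMeasure n)‖ₑ := by
            congr 1
            refine integral_congr_ae (.of_forall fun ω ↦ ?_)
            simp only
            rw [exp_ofReal_mul_I_mul_conj, real_inner_smul_left, inner_sub_left]
            congr 3
            ring
        _ ≤ _ := h
        _ ≤ _ := by
            rw [mul_assoc (C₁ : ℝ≥0∞)]
            gcongr
    calc _ ≤ ∫⁻ x', C₁ * ENNReal.ofReal ρ ^ (-β) * ‖x - x'‖ₑ ^ (-β) ∂μ := lintegral_mono hk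
      _ = C₁ * ENNReal.ofReal ρ ^ (-β) * ∫⁻ x', ‖x - x'‖ₑ ^ (-β) ∂μ :=
          lintegral_const_mul' _ _ (ENNReal.mul_ne_top ENNReal.coe_ne_top hρtop)
      _ ≤ C₁ * ENNReal.ofReal ρ ^ (-β) * (C₂ * frostman μ α) := by
          gcongr
          exact hC₂ μ hμ x
      _ = _ := by
          push_cast
          ring

lemma lintegral_Ioi_lintegral_sphereMeasure {n : ℕ} (hn : n ≠ 0) {h : E n → ℝ≥0∞}
    (hh : Measurable h) :
    ∫⁻ ρ in Set.Ioi (0 : ℝ), ENNReal.ofReal (ρ ^ (n - 1)) * ∫⁻ ω, h (ρ • ω) ∂(sphereMeasure n) =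
      ∫⁻ ξ, h ξ := by
  have hm : Measurable fun p : E n × ℝ ↦ h (p.2 • p.1) := hh.comp (by fun_prop)
  rw [← (measurePreserving_smul_sphereMeasure n hn).lintegral_comp hh, lintegral_prod_symm' _ hm,
    radialMeasure, lintegral_withDensity_eq_lintegral_mul₀ (by fun_prop)]
  · rfl
  · exact hm.lintegral_prod_left'.aemeasurable

/-- The radial profile of `ξ ↦ e^{2πi x·ξ} F(ξ)`, averaged over spheres. -/
def radialProfile {n : ℕ} (F : E n → ℂ) (x : E n) (ρ : ℝ) : ℂ :=
  (ρ ^ (n - 1) : ℝ) * ∫ ω, Complex.exp ((2 * π * (ρ * ⟪x, ω⟫) : ℝ) * Complex.I) * F (ρ • ω)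
    ∂(sphereMeasure n)

lemma integrable_smul_prod {n : ℕ} (hn : n ≠ 0) {H : E n → ℂ} (hH : Integrable H) :
    Integrable (fun p : E n × ℝ ↦ H (p.2 • p.1)) ((sphereMeasure n).prod (radialMeasure n)) :=
  (measurePreserving_smul_sphereMeasure n hn).integrable_comp_of_integrable hH

lemma integral_eq_integral_Ioi_integral_sphereMeasure {n : ℕ} (hn : n ≠ 0) {H : E n → ℂ}
    (hH : Integrable H) :
    ∫ ξ, H ξ = ∫ ρ in Set.Ioi (0 : ℝ), (ρ ^ (n - 1) : ℝ) * ∫ ω, H (ρ • ω) ∂(sphereMeasure n) := by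
  have hmp := measurePreserving_smul_sphereMeasure n hn
  have h : ∫ ξ, H ξ = ∫ p : E n × ℝ, H (p.2 • p.1) ∂((sphereMeasure n).prod (radialMeasure n)) := by
    have hH' := hH.1
    rw [← hmp.map_eq] at hH' ⊢
    exact integral_map hmp.measurable.aemeasurable hH'
  rw [h, integral_prod_symm _ (integrable_smul_prod hn hH), radialMeasure,
    integral_withDensity_eq_integral_toReal_smul (by fun_prop) (.of_forall fun _ ↦ by simp)]
  refine setIntegral_congr_fun measurableSet_Ioi fun ρ hρ ↦ ?_
  have : (0 : ℝ) ≤ ρ ^ (n - 1) := pow_nonneg (le_of_lt hρ) _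
  simp only [ENNReal.toReal_ofReal this, Complex.real_smul]

lemma integrableOn_Ioi_integral_sphereMeasure {n : ℕ} (hn : n ≠ 0) {H : E n → ℂ}
    (hH : Integrable H) :
    IntegrableOn (fun ρ : ℝ ↦ ((ρ ^ (n - 1) : ℝ) : ℂ) * ∫ ω, H (ρ • ω) ∂(sphereMeasure n))
      (Set.Ioi 0) := by
  have h := (integrable_smul_prod hn hH).integral_prod_right
  rw [radialMeasure, integrable_withDensity_iff_integrable_smul' (by fun_prop)
    (.of_forall fun _ ↦ by simp)] at h
  refine IntegrableOn.congr_fun h (fun ρ hρ ↦ ?_) measurableSet_Ioi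
  have : (0 : ℝ) ≤ ρ ^ (n - 1) := pow_nonneg (le_of_lt hρ) _
  simp only [ENNReal.toReal_ofReal this, Complex.real_smul]

lemma integrable_exp_mul {n : ℕ} {F : E n → ℂ} (hF : Integrable F) {φ : E n → ℝ}
    (hφ : Continuous φ) : Integrable fun ξ ↦ Complex.exp (φ ξ * Complex.I) * F ξ :=
  hF.bdd_mul (c := 1) (by fun_prop) (.of_forall fun _ ↦ (Complex.norm_exp_ofReal_mul_I _).le)

lemma integrableOn_radialProfile {n : ℕ} (hn : n ≠ 0) {F : E n → ℂ} (hF : Integrable F)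
    (x : E n) : IntegrableOn (radialProfile F x) (Set.Ioi 0) := by
  refine (integrableOn_Ioi_integral_sphereMeasure hn
    (integrable_exp_mul hF (φ := fun ξ ↦ 2 * π * ⟪x, ξ⟫) (by fun_prop))).congr_fun
    (fun ρ _ ↦ ?_) measurableSet_Ioi
  simp only [radialProfile, real_inner_smul_right]

lemma integral_exp_mul_eq_integral_radialProfile {n : ℕ} (hn : n ≠ 0) {F : E n → ℂ}
    (hF : Integrable F) (t : ℝ) (x : E n) :
    ∫ ξ, Complex.exp ((2 * π * (⟪x, ξ⟫ + t * ‖ξ‖) : ℝ) * Complex.I) * F ξ =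
      ∫ ρ in Set.Ioi (0 : ℝ),
        Complex.exp ((2 * π * (t * ρ) : ℝ) * Complex.I) * radialProfile F x ρ := by
  rw [integral_eq_integral_Ioi_integral_sphereMeasure hn
    (integrable_exp_mul hF (φ := fun ξ ↦ 2 * π * (⟪x, ξ⟫ + t * ‖ξ‖)) (by fun_prop))]
  refine setIntegral_congr_fun measurableSet_Ioi fun ρ hρ ↦ ?_
  simp only [radialProfile]
  rw [mul_left_comm (Complex.exp _), ← integral_const_mul (Complex.exp _)]
  congr 1
  refine integral_congr_ae ?_
  filter_upwards [sphereMeasure_ae_norm n] with ω hω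
  rw [← mul_assoc, ← Complex.exp_add, norm_smul, hω, Real.norm_of_nonneg (le_of_lt hρ),
    real_inner_smul_right]
  congr 2
  push_cast
  ring

lemma FT_eq_fourier {n : ℕ} (f : 𝓢(E n, ℂ)) : FT f = 𝓕 f := by
  ext ξ
  rw [SchwartzMap.fourier_coe, Real.fourier_eq']
  simp [FT]

lemma integrable_one_add_norm_sq_rpow_mul_norm_sq {n : ℕ} (F : 𝓢(E n, ℂ)) (s : ℝ) :
    Integrable fun ξ ↦ (1 + ‖ξ‖ ^ 2) ^ s * ‖F ξ‖ ^ 2 := by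
  set N := ⌈s⌉₊
  obtain ⟨M, hM⟩ := F.decay 0 0
  have hM' : ∀ ξ, ‖F ξ‖ ≤ M := fun ξ ↦ by simpa using hM.2 ξ
  have hpos : ∀ ξ : E n, 1 ≤ 1 + ‖ξ‖ ^ 2 := fun ξ ↦ by nlinarith [norm_nonneg ξ]
  have hint : Integrable fun ξ ↦ 2 ^ (N - 1) * (‖F ξ‖ + ‖ξ‖ ^ (2 * N) * ‖F ξ‖) * M := by
    refine (Integrable.const_mul ?_ _).mul_const _
    exact F.integrable.norm.add (F.integrable_pow_mul volume (2 * N))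
  refine hint.mono' ?_ (.of_forall fun ξ ↦ ?_)
  · refine Continuous.aestronglyMeasurable (.mul (.rpow_const (by fun_prop) fun ξ ↦ .inl ?_) ?_)
    · linarith [hpos ξ]
    · exact F.continuous.norm.pow 2
  · rw [Real.norm_of_nonneg (mul_nonneg (rpow_nonneg (by linarith [hpos ξ]) _) (by positivity))]
    calc (1 + ‖ξ‖ ^ 2) ^ s * ‖F ξ‖ ^ 2 ≤ (1 + ‖ξ‖ ^ 2) ^ (N : ℝ) * ‖F ξ‖ ^ 2 := by
          gcongr
          · exact hpos ξ
          · exact Nat.le_ceil s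
      _ = (1 + ‖ξ‖ ^ 2) ^ N * ‖F ξ‖ * ‖F ξ‖ := by rw [rpow_natCast]; ring
      _ ≤ 2 ^ (N - 1) * (1 ^ N + (‖ξ‖ ^ 2) ^ N) * ‖F ξ‖ * M := by
          gcongr
          · exact add_pow_le zero_le_one (by positivity) N
          · exact hM' ξ
      _ = _ := by
          rw [one_pow, ← pow_mul]; ring

lemma enorm_sobolevNorm_sq {n : ℕ} (f : 𝓢(E n, ℂ)) (s : ℝ) :
    ∫⁻ ξ, ENNReal.ofReal ((1 + ‖ξ‖ ^ 2) ^ s * ‖𝓕 f ξ‖ ^ 2) =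
      ENNReal.ofReal (sobolevNorm f s ^ 2) := by
  have h0 : ∀ ξ : E n, 0 ≤ (1 + ‖ξ‖ ^ 2) ^ s * ‖𝓕 f ξ‖ ^ 2 := fun ξ ↦ by positivity
  rw [← ofReal_integral_eq_lintegral_ofReal
    (integrable_one_add_norm_sq_rpow_mul_norm_sq _ s) (.of_forall h0), sobolevNorm, FT_eq_fourier,
    ← Real.rpow_natCast, ← Real.rpow_mul (integral_nonneg h0)]
  norm_num

lemma stronglyMeasurable_halfWave {n : ℕ} (f : 𝓢(E n, ℂ)) :
    StronglyMeasurable fun p : ℝ × E n ↦ halfWave f p.1 p.2 := by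
  have hF := (𝓕 f).continuous
  have h : StronglyMeasurable fun q : (ℝ × E n) × E n ↦
      Complex.exp ((2 * π * (⟪q.1.2, q.2⟫ + q.1.1 * ‖q.2‖) : ℝ) * Complex.I) * 𝓕 f q.2 := by
    refine Continuous.stronglyMeasurable ?_
    fun_prop
  simp only [halfWave, FT_eq_fourier]
  exact h.integral_prod_right'

lemma stronglyMeasurable_radialProfile {n : ℕ} {F : E n → ℂ} (hF : Continuous F) :
    StronglyMeasurable fun p : E n × ℝ ↦ radialProfile F p.1 p.2 := by
  have h : StronglyMeasurable fun q : (E n × ℝ) × E n ↦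
      Complex.exp ((2 * π * (q.1.2 * ⟪q.1.1, q.2⟫) : ℝ) * Complex.I) * F (q.1.2 • q.2) := by
    refine Continuous.stronglyMeasurable ?_
    fun_prop
  simp only [radialProfile]
  refine StronglyMeasurable.mul ?_ h.integral_prod_right'
  exact Continuous.stronglyMeasurable (by fun_prop)

lemma exists_lintegral_halfWave_sq_le {n : ℕ} (hn : n ≠ 0) :
    ∃ C : ℝ≥0, ∀ (f : 𝓢(E n, ℂ)) (x : E n),
    ∫⁻ t in Set.Ioc (0 : ℝ) 1, ‖halfWave f t x‖ₑ ^ 2 ≤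
      C * ∫⁻ ρ in Set.Ioi (0 : ℝ), ‖radialProfile (𝓕 f : 𝓢(E n, ℂ)) x ρ‖ₑ ^ 2 := by
  obtain ⟨C, hC⟩ := exists_lintegral_Ioc_enorm_integral_sq_le
  refine ⟨C, fun f x ↦ ?_⟩
  refine le_trans (le_of_eq ?_) (hC _ _ (integrableOn_radialProfile hn (𝓕 f).integrable x))
  refine lintegral_congr fun t ↦ ?_
  rw [halfWave, FT_eq_fourier, integral_exp_mul_eq_integral_radialProfile hn (𝓕 f).integrable]

lemma exists_lintegral_radialProfile_sq_le {n : ℕ} (hn : 2 ≤ n) {α β : ℝ}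
    (hβ₀ : 0 < β) (hβ : β ≤ ((n : ℝ) - 1) / 2) (hβα : β < α) :
    ∃ C : ℝ≥0, ∀ μ : Measure (E n), IsFiniteMeasure μ → μ (ball 0 1)ᶜ = 0 →
      ∀ (F : 𝓢(E n, ℂ)) (ρ : ℝ), 0 < ρ →
      ∫⁻ x, ‖radialProfile F x ρ‖ₑ ^ 2 ∂μ ≤ C * frostman μ α * (ENNReal.ofReal (ρ ^ (n - 1)) *
        ∫⁻ ω, ‖ρ • ω‖ₑ ^ ((n : ℝ) - 1 - β) * ‖F (ρ • ω)‖ₑ ^ 2 ∂(sphereMeasure n)) := by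
  obtain ⟨C, hC⟩ := exists_lintegral_enorm_integral_sphereMeasure_sq_le hn hβ₀ hβ hβα
  refine ⟨C, fun μ hμf hμ F ρ hρ ↦ ?_⟩
  have hF := F.continuous
  obtain ⟨M, hM⟩ := F.decay 0 0
  have hg : Integrable (fun ω ↦ F (ρ • ω)) (sphereMeasure n) :=
    Integrable.of_bound (Continuous.aestronglyMeasurable (by fun_prop)) M
      (.of_forall fun ω ↦ by simpa using hM.2 (ρ • ω))
  have hρ0 : ENNReal.ofReal ρ ≠ 0 := by simpa using hρ
  have hint : ∫⁻ ω, ‖ρ • ω‖ₑ ^ ((n : ℝ) - 1 - β) * ‖F (ρ • ω)‖ₑ ^ 2 ∂(sphereMeasure n) =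
      ENNReal.ofReal (ρ ^ (n - 1)) * ENNReal.ofReal ρ ^ (-β) *
        ∫⁻ ω, ‖F (ρ • ω)‖ₑ ^ 2 ∂(sphereMeasure n) := by
    rw [ENNReal.ofReal_pow hρ.le, ← ENNReal.rpow_natCast,
      ← ENNReal.rpow_add _ _ hρ0 ENNReal.ofReal_ne_top, Nat.cast_sub (by lia), Nat.cast_one,
      ← sub_eq_add_neg, ← lintegral_const_mul' _ _
        (ENNReal.rpow_ne_top_of_ne_zero hρ0 ENNReal.ofReal_ne_top)]
    refine lintegral_congr_ae ?_
    filter_upwards [sphereMeasure_ae_norm n] with ω hω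
    rw [← ofReal_norm (ρ • ω), norm_smul, hω, mul_one, Real.norm_of_nonneg hρ.le]
  have hpow : ‖((ρ ^ (n - 1) : ℝ) : ℂ)‖ₑ = ENNReal.ofReal (ρ ^ (n - 1)) := by
    rw [← ofReal_norm, Complex.norm_real, Real.norm_of_nonneg (by positivity)]
  rw [hint]
  simp only [radialProfile, enorm_mul, mul_pow, hpow]
  rw [lintegral_const_mul' _ _ (by simp)]
  calc _ ≤ ENNReal.ofReal (ρ ^ (n - 1)) ^ 2 * (C * frostman μ α * ENNReal.ofReal ρ ^ (-β) *
        ∫⁻ ω, ‖F (ρ • ω)‖ₑ ^ 2 ∂(sphereMeasure n)) := by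
        gcongr
        exact hC μ hμf hμ ρ hρ _ hg
    _ = _ := by ring

lemma lintegral_enorm_rpow_mul_fourier_sq_le {n : ℕ} (f : 𝓢(E n, ℂ)) {γ s : ℝ} (hγ : 0 ≤ γ)
    (hs : γ ≤ 2 * s) :
    ∫⁻ ξ, ‖ξ‖ₑ ^ γ * ‖𝓕 f ξ‖ₑ ^ 2 ≤ ENNReal.ofReal (sobolevNorm f s ^ 2) := by
  rw [← enorm_sobolevNorm_sq]
  refine lintegral_mono fun ξ ↦ ?_
  have h1 : 1 ≤ 1 + ‖ξ‖ ^ 2 := by nlinarith [norm_nonneg ξ]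
  simp only
  rw [← ofReal_norm, ← ofReal_norm, ENNReal.ofReal_rpow_of_nonneg (norm_nonneg _) hγ,
    ← ENNReal.ofReal_pow (norm_nonneg _), ← ENNReal.ofReal_mul (by positivity)]
  gcongr
  calc ‖ξ‖ ^ γ = (‖ξ‖ ^ 2) ^ (γ / 2) := by
        rw [← Real.rpow_natCast, ← Real.rpow_mul (norm_nonneg _)]
        congr 1
        push_cast
        ring
    _ ≤ (1 + ‖ξ‖ ^ 2) ^ (γ / 2) := by gcongr; linarith
    _ ≤ (1 + ‖ξ‖ ^ 2) ^ s := Real.rpow_le_rpow_of_exponent_le h1 (by linarith)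

lemma exists_lintegral_lintegral_halfWave_sq_le {n : ℕ} (hn : 2 ≤ n) {α β s : ℝ}
    (hβ₀ : 0 < β) (hβ : β ≤ ((n : ℝ) - 1) / 2) (hβα : β < α) (hs : (n : ℝ) - 1 - β ≤ 2 * s) :
    ∃ C : ℝ≥0, ∀ μ : Measure (E n), IsFiniteMeasure μ → μ (ball 0 1)ᶜ = 0 → frostman μ α < ⊤ →
      ∀ f : 𝓢(E n, ℂ), ∫⁻ t in Set.Ioc (0 : ℝ) 1, ∫⁻ x, ‖halfWave f t x‖ₑ ^ 2 ∂μ ≤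
        C * frostman μ α * ENNReal.ofReal (sobolevNorm f s ^ 2) := by
  have hn0 : n ≠ 0 := by lia
  obtain ⟨C₁, hC₁⟩ := exists_lintegral_halfWave_sq_le hn0
  obtain ⟨C₂, hC₂⟩ := exists_lintegral_radialProfile_sq_le hn hβ₀ hβ hβα
  refine ⟨C₁ * C₂, fun μ hμf hμ hμα f ↦ ?_⟩
  have hF := (𝓕 f).continuous
  have hn1 : (2 : ℝ) ≤ n := by exact_mod_cast hn
  calc ∫⁻ t in Set.Ioc (0 : ℝ) 1, ∫⁻ x, ‖halfWave f t x‖ₑ ^ 2 ∂μ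
      = ∫⁻ x, (∫⁻ t in Set.Ioc (0 : ℝ) 1, ‖halfWave f t x‖ₑ ^ 2) ∂μ :=
        lintegral_lintegral_swap
          ((stronglyMeasurable_halfWave f).measurable.enorm.pow_const 2).aemeasurable
    _ ≤ ∫⁻ x, (C₁ * ∫⁻ ρ in Set.Ioi (0 : ℝ), ‖radialProfile (𝓕 f : 𝓢(E n, ℂ)) x ρ‖ₑ ^ 2) ∂μ :=
        lintegral_mono fun x ↦ hC₁ f x
    _ = C₁ * ∫⁻ ρ in Set.Ioi (0 : ℝ), ∫⁻ x, ‖radialProfile (𝓕 f : 𝓢(E n, ℂ)) x ρ‖ₑ ^ 2 ∂μ := by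
        rw [lintegral_const_mul' _ _ ENNReal.coe_ne_top, lintegral_lintegral_swap]
        exact ((stronglyMeasurable_radialProfile hF).measurable.enorm.pow_const 2).aemeasurable
    _ ≤ C₁ * ∫⁻ ρ in Set.Ioi (0 : ℝ), C₂ * frostman μ α * (ENNReal.ofReal (ρ ^ (n - 1)) *
          ∫⁻ ω, ‖ρ • ω‖ₑ ^ ((n : ℝ) - 1 - β) * ‖𝓕 f (ρ • ω)‖ₑ ^ 2 ∂(sphereMeasure n)) := by
        gcongr 1
        exact setLIntegral_mono' measurableSet_Ioi fun ρ hρ ↦ hC₂ μ hμf hμ (𝓕 f) ρ hρ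
    _ = C₁ * (C₂ * frostman μ α * ∫⁻ ξ, ‖ξ‖ₑ ^ ((n : ℝ) - 1 - β) * ‖𝓕 f ξ‖ₑ ^ 2) := by
        rw [lintegral_const_mul' _ _ (ENNReal.mul_ne_top ENNReal.coe_ne_top hμα.ne),
          lintegral_Ioi_lintegral_sphereMeasure hn0
            (h := fun ξ ↦ ‖ξ‖ₑ ^ ((n : ℝ) - 1 - β) * ‖𝓕 f ξ‖ₑ ^ 2)]
        exact (measurable_enorm.pow_const _).mul (hF.measurable.enorm.pow_const 2)
    _ ≤ C₁ * (C₂ * frostman μ α * ENNReal.ofReal (sobolevNorm f s ^ 2)) := by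
        gcongr
        exact lintegral_enorm_rpow_mul_fourier_sq_le f (by linarith) hs
    _ = _ := by
        push_cast
        ring

lemma ofReal_intervalIntegral_integral_sq_le {X : Type*} [MeasurableSpace X] (μ : Measure X)
    (u : ℝ → X → ℂ) :
    ENNReal.ofReal (∫ t in (0 : ℝ)..1, ∫ x, ‖u t x‖ ^ 2 ∂μ) ≤
      ∫⁻ t in Set.Ioc (0 : ℝ) 1, ∫⁻ x, ‖u t x‖ₑ ^ 2 ∂μ := by
  rw [intervalIntegral.integral_of_le zero_le_one]
  refine (Real.ofReal_le_enorm _).trans ((enorm_integral_le_lintegral_enorm _).trans ?_)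
  refine lintegral_mono fun t ↦ (enorm_integral_le_lintegral_enorm _).trans (le_of_eq ?_)
  simp

/-- the `L²` Strichartz estimate with respect to fractal measures holds with
`s > (n-α-1)/2` in the range `0 < α ≤ (n-1)/2`. -/
theorem strichartz_L2_low_dimension (n : ℕ) (hn : 2 ≤ n) (α s : ℝ)
    (hα₀ : 0 < α) (hα₁ : α ≤ ((n : ℝ) - 1) / 2) (hs : ((n : ℝ) - α - 1) / 2 < s) :
    ∃ C : ℝ, 0 < C ∧
      ∀ (μ : Measure (E n)), IsFiniteMeasure μ →
        μ (Metric.ball (0 : E n) 1)ᶜ = 0 → frostman μ α < ⊤ →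
        ∀ (f : SchwartzMap (E n) ℂ),
          (∫ t in (0:ℝ)..1, ∫ x, ‖halfWave (⇑f) t x‖ ^ 2 ∂μ) ≤
            C * (frostman μ α).toReal * sobolevNorm (⇑f) s ^ 2 := by
  have hβ₀ : 0 < max ((n : ℝ) - 1 - 2 * s) (α / 2) := lt_max_of_lt_right (by linarith)
  have hβα : max ((n : ℝ) - 1 - 2 * s) (α / 2) < α := max_lt (by linarith) (by linarith)
  have hβs := le_max_left ((n : ℝ) - 1 - 2 * s) (α / 2)
  obtain ⟨C, hC⟩ := exists_lintegral_lintegral_halfWave_sq_le hn (s := s) hβ₀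
    (hβα.le.trans hα₁) hβα (by linarith)
  refine ⟨C + 1, by positivity, fun μ hμf hμ hμα f ↦ ?_⟩
  have h := (ofReal_intervalIntegral_integral_sq_le μ (halfWave f)).trans (hC μ hμf hμ hμα f)
  have hrw : C * frostman μ α * ENNReal.ofReal (sobolevNorm f s ^ 2) =
      ENNReal.ofReal (C * (frostman μ α).toReal * sobolevNorm f s ^ 2) := by
    rw [ENNReal.ofReal_mul (by positivity), ENNReal.ofReal_mul C.coe_nonneg,
      ENNReal.ofReal_coe_nnreal, ENNReal.ofReal_toReal hμα.ne]
  rw [hrw, ENNReal.ofReal_le_ofReal_iff (by positivity)] at h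
  refine h.trans ?_
  gcongr
  linarith
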